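/- Diminishing bound for the CADA1 gradient-innovation test quantity (inequality (8) of the paper, finite-sample form). Assume the convex finite-sum setup. Then for every m ∈ {1, …, M} and all θ, θ', θ̃ ∈ ℝ^p: (1/n²) ∑_{j=1}^n ∑_{j'=1}^n ‖(∇ℓ_{m,j}(θ) − ∇ℓ_{m,j}(θ̃)) − (∇ℓ_{m,j'}(θ') − ∇ℓ_{m,j'}(θ̃))‖² ≤ 8 M L̄ (L(θ) − L(θ*)) + 8 M L̄ (L(θ') − L(θ*)) + 16 M L̄ (L(θ̃) − L(θ*)). -/

import Mathlib

open scoped RealInnerProductSpace BigOperators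

noncomputable section

section Gradient

variable {E : Type*} [NormedAddCommGroup E] [InnerProductSpace ℝ E] [CompleteSpace E]

lemma HasGradientAt.hasDerivAt_line {f : E → ℝ} {g x v : E} {t : ℝ}
    (h : HasGradientAt f g (x + t • v)) :
    HasDerivAt (fun s : ℝ => f (x + s • v)) ⟪g, v⟫ t := by
  have hline : HasDerivAt (fun s : ℝ => x + s • v) v t := by
    simpa using ((hasDerivAt_id t).smul_const v).const_add x
  exact h.hasFDerivAt.comp_hasDerivAt t hline

/-- A convex function lies above its tangent hyperplanes. -/
lemma ConvexOn.add_inner_gradient_le {f : E → ℝ} {g x : E} (hf : ConvexOn ℝ Set.univ f)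
    (h : HasGradientAt f g x) (y : E) : f x + ⟪g, y - x⟫ ≤ f y := by
  have hc : ConvexOn ℝ Set.univ (fun s : ℝ => f (x + s • (y - x))) := by
    have := hf.comp_affineMap (AffineMap.lineMap (k := ℝ) x y)
    simpa [Function.comp_def, AffineMap.lineMap_apply, add_comm] using this
  have hd : HasDerivAt (fun s : ℝ => f (x + s • (y - x))) ⟪g, y - x⟫ 0 :=
    HasGradientAt.hasDerivAt_line (by simpa using h)
  have := hc.le_slope_of_hasDerivAt (Set.mem_univ 0) (Set.mem_univ 1) one_pos hd
  simp [slope_def_field] at this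
  simp only [inner_sub_right] at this ⊢
  linarith

/-- The descent lemma for functions with Lipschitz gradient. -/
lemma LipschitzWith.le_add_inner_gradient_add {f : E → ℝ} {g : E → E} {K : NNReal}
    (hg : ∀ x, HasGradientAt f (g x) x) (hK : LipschitzWith K g) (x v : E) :
    f (x + v) ≤ f x + ⟪g x, v⟫ + K / 2 * ‖v‖ ^ 2 := by
  have hd (t : ℝ) : HasDerivAt
      (fun s : ℝ => f (x + s • v) - s * ⟪g x, v⟫ - s ^ 2 * (K / 2 * ‖v‖ ^ 2))
      (⟪g (x + t • v), v⟫ - ⟪g x, v⟫ - 2 * t * (K / 2 * ‖v‖ ^ 2)) t := by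
    have h1 := (hg (x + t • v)).hasDerivAt_line
    have h2 := (hasDerivAt_id t).mul_const ⟪g x, v⟫
    have h3 := (hasDerivAt_pow 2 t).mul_const (K / 2 * ‖v‖ ^ 2)
    simpa using! (h1.sub h2).sub h3
  have hanti := antitoneOn_of_hasDerivWithinAt_nonpos (convex_Ici (0 : ℝ))
    (fun t _ => (hd t).continuousAt.continuousWithinAt)
    (fun t _ => (hd t).hasDerivWithinAt) (fun t ht => by
      have ht : 0 < t := by simpa using ht
      have h1 : ⟪g (x + t • v) - g x, v⟫ ≤ K * (t * ‖v‖) * ‖v‖ := by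
        refine (real_inner_le_norm _ _).trans ?_
        gcongr
        simpa [dist_eq_norm, norm_smul, abs_of_pos ht] using hK.dist_le_mul (x + t • v) x
      rw [inner_sub_left] at h1
      linarith)
  have := hanti (Set.mem_Ici.2 le_rfl) (Set.mem_Ici.2 zero_le_one) zero_le_one
  simp at this
  linarith

/-- For a convex function with `K`-Lipschitz gradient, the Bregman divergence controls the squared
distance between gradients. -/
lemma ConvexOn.norm_gradient_sub_sq_le {f : E → ℝ} {g : E → E} {K : NNReal} (hK0 : 0 < K)
    (hf : ConvexOn ℝ Set.univ f) (hg : ∀ x, HasGradientAt f (g x) x) (hK : LipschitzWith K g)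
    (x y : E) : ‖g x - g y‖ ^ 2 ≤ 2 * K * (f x - f y - ⟪g y, x - y⟫) := by
  have hK0' : (0 : ℝ) < K := hK0
  set u := g x - g y with hu
  have h1 := hK.le_add_inner_gradient_add hg x (-((K : ℝ)⁻¹ • u))
  have h2 := hf.add_inner_gradient_le (hg y) (x + -((K : ℝ)⁻¹ • u))
  have h3 : ⟪g x, u⟫ - ⟪g y, u⟫ = ‖u‖ ^ 2 := by
    rw [← inner_sub_left, ← hu, real_inner_self_eq_norm_sq]
  simp only [inner_sub_right, inner_add_right, inner_neg_right, inner_smul_right, norm_neg,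
    norm_smul, norm_inv, Real.norm_eq_abs, abs_of_pos hK0', mul_pow] at h1 h2 ⊢
  have h4 : (K : ℝ)⁻¹ * ⟪g x, u⟫ = (K : ℝ)⁻¹ * ⟪g y, u⟫ + (K : ℝ)⁻¹ * ‖u‖ ^ 2 := by
    rw [← h3]; ring
  have h5 : (K : ℝ) / 2 * ((K : ℝ)⁻¹ ^ 2 * ‖u‖ ^ 2) = (K : ℝ)⁻¹ * ‖u‖ ^ 2 / 2 := by
    field_simp
  have h6 : (K : ℝ)⁻¹ * ‖u‖ ^ 2 ≤ 2 * (f x - f y - (⟪g y, x⟫ - ⟪g y, y⟫)) := by linarith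
  have h7 := (inv_mul_le_iff₀ hK0').1 h6
  linarith

end Gradient

lemma norm_sub_sub_sub_sq_le {E : Type*} [SeminormedAddCommGroup E] (a b c d : E) :
    ‖(a - b) - (c - d)‖ ^ 2 ≤ 4 * (‖a‖ ^ 2 + ‖b‖ ^ 2 + ‖c‖ ^ 2 + ‖d‖ ^ 2) := by
  have h : ‖(a - b) - (c - d)‖ ≤ ‖a‖ + ‖b‖ + (‖c‖ + ‖d‖) :=
    (norm_sub_le _ _).trans (add_le_add (norm_sub_le _ _) (norm_sub_le _ _))
  have h2 := pow_le_pow_left₀ (norm_nonneg _) h 2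
  nlinarith [sq_nonneg (‖a‖ - ‖b‖), sq_nonneg (‖c‖ - ‖d‖), sq_nonneg (‖a‖ - ‖c‖),
    sq_nonneg (‖a‖ - ‖d‖), sq_nonneg (‖b‖ - ‖c‖), sq_nonneg (‖b‖ - ‖d‖)]

/-- At a minimizer of a finite sum of convex functions with `K`-Lipschitz gradients, the excess
value of the sum controls the variation of the individual gradients. -/
lemma sum_norm_gradient_sub_sq_le {ι E : Type*} [Fintype ι] [NormedAddCommGroup E]
    [InnerProductSpace ℝ E] [CompleteSpace E] {f : ι → E → ℝ} {g : ι → E → E} {K : NNReal}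
    (hK0 : 0 < K) (hf : ∀ i, ConvexOn ℝ Set.univ (f i))
    (hg : ∀ i x, HasGradientAt (f i) (g i x) x) (hK : ∀ i, LipschitzWith K (g i)) {y : E}
    (hy : ∀ x, ∑ i, f i y ≤ ∑ i, f i x) (x : E) :
    ∑ i, ‖g i x - g i y‖ ^ 2 ≤ 2 * K * (∑ i, f i x - ∑ i, f i y) := by
  have hd : HasDerivAt (fun s : ℝ => ∑ i, f i (y + s • (x - y))) (∑ i, ⟪g i y, x - y⟫) 0 :=
    HasDerivAt.fun_sum fun i _ => HasGradientAt.hasDerivAt_line (by simpa using hg i y)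
  have h0 : ∑ i, ⟪g i y, x - y⟫ = 0 :=
    IsLocalMin.hasDerivAt_eq_zero (Filter.Eventually.of_forall fun s => by
      simpa using hy (y + s • (x - y))) hd
  calc ∑ i, ‖g i x - g i y‖ ^ 2
      ≤ ∑ i, 2 * K * (f i x - f i y - ⟪g i y, x - y⟫) :=
        Finset.sum_le_sum fun i _ => (hf i).norm_gradient_sub_sq_le hK0 (hg i) (hK i) x y
    _ = 2 * K * (∑ i, f i x - ∑ i, f i y) := by
        rw [← Finset.mul_sum, Finset.sum_sub_distrib, Finset.sum_sub_distrib, h0, sub_zero]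

/-- Diminishing bound for the CADA1 gradient-innovation test quantity
(inequality (8) of the paper, finite-sample form). -/
theorem cada1_innovation_bound
    (p n M : ℕ) (hp : 1 ≤ p) (hn : 1 ≤ n) (hM : 1 ≤ M) (Lbar : ℝ) (hLbar : 0 < Lbar)
    (ℓ : Fin M → Fin n → EuclideanSpace ℝ (Fin p) → ℝ)
    (gℓ : Fin M → Fin n → EuclideanSpace ℝ (Fin p) → EuclideanSpace ℝ (Fin p))
    (hconv : ∀ m j, ConvexOn ℝ Set.univ (ℓ m j))
    (hgrad : ∀ m j x, HasGradientAt (ℓ m j) (gℓ m j x) x)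
    (hlip : ∀ m j, LipschitzWith Lbar.toNNReal (gℓ m j))
    (Lm : Fin M → EuclideanSpace ℝ (Fin p) → ℝ)
    (hLm : ∀ m x, Lm m x = (n : ℝ)⁻¹ * ∑ j, ℓ m j x)
    (gLm : Fin M → EuclideanSpace ℝ (Fin p) → EuclideanSpace ℝ (Fin p))
    (hgLm : ∀ m x, HasGradientAt (Lm m) (gLm m x) x)
    (L : EuclideanSpace ℝ (Fin p) → ℝ)
    (hL : ∀ x, L x = (M : ℝ)⁻¹ * ∑ m, Lm m x)
    (θstar : EuclideanSpace ℝ (Fin p))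
    (hmin : ∀ x, L θstar ≤ L x)
    :
    ∀ (m : Fin M) (θ θ' θtil : EuclideanSpace ℝ (Fin p)),
      (n : ℝ)⁻¹ * (n : ℝ)⁻¹ *
          ∑ j, ∑ j', ‖(gℓ m j θ - gℓ m j θtil) - (gℓ m j' θ' - gℓ m j' θtil)‖ ^ 2 ≤
        8 * M * Lbar * (L θ - L θstar) + 8 * M * Lbar * (L θ' - L θstar)
          + 16 * M * Lbar * (L θtil - L θstar) := by
  intro m θ θ' θtil
  have hn0 : (0 : ℝ) < n := by exact_mod_cast hn
  have hM0 : (0 : ℝ) < M := by exact_mod_cast hM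
  have hsum (x) : ∑ i : Fin M × Fin n, ℓ i.1 i.2 x = M * n * L x := by
    simp only [hL, hLm, ← Finset.mul_sum, Fintype.sum_prod_type]
    field_simp
  have key (x) : ∑ j, ‖gℓ m j x - gℓ m j θstar‖ ^ 2 ≤ 2 * Lbar * (M * n * (L x - L θstar)) := by
    have h := sum_norm_gradient_sub_sq_le (f := fun i : Fin M × Fin n => ℓ i.1 i.2)
      (g := fun i => gℓ i.1 i.2) (Real.toNNReal_pos.2 hLbar) (fun i => hconv i.1 i.2)
      (fun i => hgrad i.1 i.2) (fun i => hlip i.1 i.2) (y := θstar) (fun x => by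
        rw [hsum, hsum]
        gcongr
        exact hmin x) x
    rw [hsum, hsum, Real.coe_toNNReal _ hLbar.le, ← mul_sub, Fintype.sum_prod_type] at h
    exact (Finset.single_le_sum (f := fun m => ∑ j, ‖gℓ m j x - gℓ m j θstar‖ ^ 2)
      (fun _ _ => by positivity) (Finset.mem_univ m)).trans h
  rw [← mul_inv, inv_mul_le_iff₀ (by positivity)]
  calc ∑ j, ∑ j', ‖(gℓ m j θ - gℓ m j θtil) - (gℓ m j' θ' - gℓ m j' θtil)‖ ^ 2
      ≤ ∑ j, ∑ j', 4 * (‖gℓ m j θ - gℓ m j θstar‖ ^ 2 + ‖gℓ m j θtil - gℓ m j θstar‖ ^ 2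
          + ‖gℓ m j' θ' - gℓ m j' θstar‖ ^ 2 + ‖gℓ m j' θtil - gℓ m j' θstar‖ ^ 2) := by
        gcongr with j _ j' _
        simpa using norm_sub_sub_sub_sq_le (gℓ m j θ - gℓ m j θstar) (gℓ m j θtil - gℓ m j θstar)
          (gℓ m j' θ' - gℓ m j' θstar) (gℓ m j' θtil - gℓ m j' θstar)
    _ = 4 * n * (∑ j, ‖gℓ m j θ - gℓ m j θstar‖ ^ 2 + ∑ j, ‖gℓ m j θ' - gℓ m j θstar‖ ^ 2
          + 2 * ∑ j, ‖gℓ m j θtil - gℓ m j θstar‖ ^ 2) := by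
        simp only [← Finset.mul_sum, Finset.sum_add_distrib, Finset.sum_const, Finset.card_univ,
          Fintype.card_fin, nsmul_eq_mul]
        ring
    _ ≤ 4 * n * (2 * Lbar * (M * n * (L θ - L θstar)) + 2 * Lbar * (M * n * (L θ' - L θstar))
          + 2 * (2 * Lbar * (M * n * (L θtil - L θstar)))) := by
        gcongr <;> exact key _
    _ = _ := by ring
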